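/- Fix integers m, n ≥ 1 and h > 0, and let ∇_h and div_h be the forward-difference discrete gradient and its negative adjoint discrete divergence on the m×n grid with mesh size h. Let g ∈ ℝ^{m×n} satisfy Σ_{i,j} g_{i,j} = 0. Then the discrete Beckmann problem min { h² Σ_{i,j} ‖Φ_{i,j}‖₂ : Φ ∈ ℝ^{m×n×2}, div_h Φ = g } and the discrete Kantorovich problem max { h² Σ_{i,j} g_{i,j} p_{i,j} : p ∈ ℝ^{m×n}, ‖(∇_h p)_{i,j}‖₂ ≤ 1 for all (i,j) } are both attained (the first set being nonempty), and their optimal values are equal. -/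

import Mathlib

open Finset

/-- First component of the forward-difference discrete gradient on an `m × n` grid with
mesh size `h` (zero in the last row). -/
noncomputable def dGrad1 (m n : ℕ) (h : ℝ) (u : Fin m → Fin n → ℝ)
    (i : Fin m) (j : Fin n) : ℝ :=
  if hi : (i : ℕ) + 1 < m then (u ⟨(i : ℕ) + 1, hi⟩ j - u i j) / h else 0

/-- Second component of the forward-difference discrete gradient (zero in the last column). -/
noncomputable def dGrad2 (m n : ℕ) (h : ℝ) (u : Fin m → Fin n → ℝ)
    (i : Fin m) (j : Fin n) : ℝ :=
  if hj : (j : ℕ) + 1 < n then (u i ⟨(j : ℕ) + 1, hj⟩ - u i j) / h else 0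

/-- Discrete divergence `div_h = −∇_h*` with homogeneous Neumann boundary conditions. -/
noncomputable def dDiv (m n : ℕ) (h : ℝ) (φ1 φ2 : Fin m → Fin n → ℝ)
    (i : Fin m) (j : Fin n) : ℝ :=
  ((if _ : (i : ℕ) + 1 < m then φ1 i j else 0)
    - (if _ : 0 < (i : ℕ) then
        φ1 ⟨(i : ℕ) - 1, lt_of_le_of_lt (Nat.sub_le _ _) i.isLt⟩ j else 0)) / h
  + ((if _ : (j : ℕ) + 1 < n then φ2 i j else 0)
    - (if _ : 0 < (j : ℕ) then
        φ2 i ⟨(j : ℕ) - 1, lt_of_le_of_lt (Nat.sub_le _ _) j.isLt⟩ else 0)) / h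

theorem ibp1 (m : ℕ) (h : ℝ) (a p : Fin m → ℝ) :
    ∑ i : Fin m, ((if _ : (i : ℕ) + 1 < m then a i else 0)
      - (if _ : 0 < (i : ℕ) then
        a ⟨(i : ℕ) - 1, lt_of_le_of_lt (Nat.sub_le _ _) i.isLt⟩ else 0)) / h * p i
    = - ∑ i : Fin m, a i * (if hi : (i : ℕ) + 1 < m then (p ⟨(i : ℕ) + 1, hi⟩ - p i) / h else 0) := by
  cases m with
  | zero => simp
  | succ k =>
    simp only [sub_div, sub_mul, Finset.sum_sub_distrib]
    rw [Fin.sum_univ_castSucc, Fin.sum_univ_succ (n := k), Fin.sum_univ_castSucc (n := k), ← sub_eq_zero]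
    have z : ¬ (0 < ((0 : Fin (k + 1)) : ℕ)) := by simp
    rw [dif_neg z]
    simp only [Fin.val_castSucc, Fin.val_last, Fin.val_succ, Fin.val_zero]
    have e : ∀ x : Fin k, (x : ℕ) + 1 < k + 1 := fun x => by omega
    simp only [e, lt_irrefl, dif_pos, dif_neg, not_false_eq_true, Nat.succ_pos, Nat.add_sub_cancel,
      zero_div, zero_mul, mul_zero, add_zero, zero_add]
    rw [← Finset.sum_sub_distrib, sub_neg_eq_add, ← Finset.sum_add_distrib]
    apply Finset.sum_eq_zero
    intro x _
    have e1 : (⟨(x : ℕ), by omega⟩ : Fin (k+1)) = x.castSucc := rfl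
    have e2 : (⟨(x : ℕ) + 1, by omega⟩ : Fin (k+1)) = x.succ := rfl
    simp only [e1, e2]
    ring

theorem ibp (m n : ℕ) (h : ℝ) (φ1 φ2 p : Fin m → Fin n → ℝ) :
    ∑ i : Fin m, ∑ j : Fin n, dDiv m n h φ1 φ2 i j * p i j
    = - ∑ i : Fin m, ∑ j : Fin n,
      (φ1 i j * dGrad1 m n h p i j + φ2 i j * dGrad2 m n h p i j) := by
  simp only [dDiv, dGrad1, dGrad2, add_mul, Finset.sum_add_distrib, neg_add]
  congr 1
  · rw [Finset.sum_comm, Finset.sum_comm (f := fun i j => φ1 i j * _), ← Finset.sum_neg_distrib]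
    exact Finset.sum_congr rfl fun j _ => ibp1 m h (fun i => φ1 i j) (fun i => p i j)
  · rw [← Finset.sum_neg_distrib]
    exact Finset.sum_congr rfl fun i _ => ibp1 n h (φ2 i) (p i)

theorem weak_dual (m n : ℕ) (h : ℝ) (φ1 φ2 p : Fin m → Fin n → ℝ)
    (hp : ∀ i j, Real.sqrt (dGrad1 m n h p i j ^ 2 + dGrad2 m n h p i j ^ 2) ≤ 1) :
    ∑ i : Fin m, ∑ j : Fin n, dDiv m n h φ1 φ2 i j * p i j
      ≤ ∑ i : Fin m, ∑ j : Fin n, Real.sqrt (φ1 i j ^ 2 + φ2 i j ^ 2) := by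
  rw [ibp, ← Finset.sum_neg_distrib]
  refine Finset.sum_le_sum fun i _ => ?_
  rw [← Finset.sum_neg_distrib]
  refine Finset.sum_le_sum fun j _ => ?_
  have h1 := hp i j
  rw [Real.sqrt_le_iff, one_pow] at h1
  replace h1 := h1.2
  apply Real.le_sqrt_of_sq_le
  generalize dGrad1 m n h p i j = a at *
  generalize dGrad2 m n h p i j = b at *
  generalize φ1 i j = x at *
  generalize φ2 i j = y at *
  nlinarith [sq_nonneg (x * b - y * a), mul_le_mul_of_nonneg_left h1 (add_nonneg (sq_nonneg x) (sq_nonneg y))]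

theorem grad_le (m n : ℕ) (h : ℝ) (p : Fin m → Fin n → ℝ)
    (H : ∀ φ1 φ2 : Fin m → Fin n → ℝ, ∑ i : Fin m, ∑ j : Fin n, dDiv m n h φ1 φ2 i j * p i j
      ≤ ∑ i : Fin m, ∑ j : Fin n, Real.sqrt (φ1 i j ^ 2 + φ2 i j ^ 2)) (i : Fin m) (j : Fin n) :
    Real.sqrt (dGrad1 m n h p i j ^ 2 + dGrad2 m n h p i j ^ 2) ≤ 1 := by
  have h1 := H (fun a b => if a = i then if b = j then - dGrad1 m n h p i j else 0 else 0)
    (fun a b => if a = i then if b = j then - dGrad2 m n h p i j else 0 else 0)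
  rw [ibp] at h1
  have e : ∑ a : Fin m, ∑ b : Fin n, Real.sqrt
      ((if a = i then if b = j then - dGrad1 m n h p i j else 0 else 0) ^ 2 +
       (if a = i then if b = j then - dGrad2 m n h p i j else 0 else 0) ^ 2)
      = Real.sqrt (dGrad1 m n h p i j ^ 2 + dGrad2 m n h p i j ^ 2) := by
    rw [Finset.sum_eq_single i, Finset.sum_eq_single j]
    · simp
    · intro b _ hb; simp [hb]
    · simp
    · intro b _ hb; simp [hb]
    · simp
  rw [e] at h1
  have e2 : ∑ a : Fin m, ∑ b : Fin n,
      ((if a = i then if b = j then - dGrad1 m n h p i j else 0 else 0) * dGrad1 m n h p a b +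
       (if a = i then if b = j then - dGrad2 m n h p i j else 0 else 0) * dGrad2 m n h p a b)
      = - (dGrad1 m n h p i j ^ 2 + dGrad2 m n h p i j ^ 2) := by
    rw [Finset.sum_eq_single i, Finset.sum_eq_single j]
    · simp; ring
    · intro b _ hb; simp [hb]
    · simp
    · intro b _ hb; simp [hb]
    · simp
  rw [e2, neg_neg] at h1
  have h0 : 0 ≤ dGrad1 m n h p i j ^ 2 + dGrad2 m n h p i j ^ 2 := by positivity
  have h2 := Real.sq_sqrt h0
  have h3 := Real.sqrt_nonneg (dGrad1 m n h p i j ^ 2 + dGrad2 m n h p i j ^ 2)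
  by_contra hc
  push Not at hc
  nlinarith

theorem const_of_grad (m n : ℕ) (h : ℝ) (hh : 0 < h) (p : Fin m → Fin n → ℝ)
    (H1 : ∀ i j, dGrad1 m n h p i j = 0) (H2 : ∀ i j, dGrad2 m n h p i j = 0)
    (hm : 0 < m) (hn : 0 < n) (i : Fin m) (j : Fin n) : p i j = p ⟨0, hm⟩ ⟨0, hn⟩ := by
  have A : ∀ k (hk : k < m), p ⟨k, hk⟩ j = p ⟨0, hm⟩ j := by
    intro k
    induction k with
    | zero => intro _; rfl
    | succ k ih =>
      intro hk
      have := H1 ⟨k, by omega⟩ j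
      simp only [dGrad1, hk, dif_pos, div_eq_zero_iff, hh.ne', or_false] at this
      rw [← ih (by omega)]; linarith
  have B : ∀ k (hk : k < n), p ⟨0, hm⟩ ⟨k, hk⟩ = p ⟨0, hm⟩ ⟨0, hn⟩ := by
    intro k
    induction k with
    | zero => intro _; rfl
    | succ k ih =>
      intro hk
      have := H2 ⟨0, hm⟩ ⟨k, by omega⟩
      simp only [dGrad2, hk, dif_pos, div_eq_zero_iff, hh.ne', or_false] at this
      rw [← ih (by omega)]; linarith
  rw [← B j j.2]; exact A i i.2

abbrev FlowSp (m n : ℕ) := PiLp 1 (fun _ : Fin m × Fin n => EuclideanSpace ℝ (Fin 2))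

noncomputable def mkFlow (m n : ℕ) (φ1 φ2 : Fin m → Fin n → ℝ) : FlowSp m n :=
  WithLp.toLp 1 (fun x => !₂[φ1 x.1 x.2, φ2 x.1 x.2])

noncomputable def divL (m n : ℕ) (h : ℝ) : FlowSp m n →ₗ[ℝ] (Fin m → Fin n → ℝ) where
  toFun Φ := dDiv m n h (fun i j => Φ (i, j) 0) (fun i j => Φ (i, j) 1)
  map_add' Φ Ψ := by
    funext i j
    simp only [dDiv, PiLp.add_apply, Pi.add_apply]
    split_ifs <;> ring
  map_smul' c Φ := by
    funext i j
    simp only [dDiv, PiLp.smul_apply, Pi.smul_apply, smul_eq_mul, RingHom.id_apply]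
    split_ifs <;> ring

theorem norm_flow (m n : ℕ) (Φ : FlowSp m n) :
    ‖Φ‖ = ∑ i : Fin m, ∑ j : Fin n, Real.sqrt (Φ (i, j) 0 ^ 2 + Φ (i, j) 1 ^ 2) := by
  rw [PiLp.norm_eq_of_L1, Fintype.sum_prod_type]
  simp [EuclideanSpace.norm_eq, Fin.sum_univ_two]

theorem dual_repr (m n : ℕ) (q : (Fin m → Fin n → ℝ) →ₗ[ℝ] ℝ) :
    ∃ p : Fin m → Fin n → ℝ, ∀ u, q u = ∑ i : Fin m, ∑ j : Fin n, u i j * p i j := by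
  refine ⟨fun i j => q (Pi.single i (Pi.single j 1)), fun u => ?_⟩
  have : u = ∑ i : Fin m, ∑ j : Fin n, u i j • (Pi.single i (Pi.single j 1) : Fin m → Fin n → ℝ) := by
    funext a b
    simp [Finset.sum_apply, Pi.single_apply, apply_ite, ite_apply]
  conv_lhs => rw [this]
  simp [map_sum]

theorem feas (m n : ℕ) (hm : 1 ≤ m) (hn : 1 ≤ n) (h : ℝ) (hh : 0 < h)
    (g : Fin m → Fin n → ℝ) (hg : ∑ i : Fin m, ∑ j : Fin n, g i j = 0) :
    ∃ Φ, divL m n h Φ = g := by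
  by_contra hc
  have hn' : g ∉ LinearMap.range (divL m n h) := hc
  obtain ⟨q, hq, hq2⟩ := Submodule.exists_le_ker_of_notMem hn'
  obtain ⟨p, hp⟩ := dual_repr m n q
  have H : ∀ φ1 φ2 : Fin m → Fin n → ℝ,
      ∑ i : Fin m, ∑ j : Fin n, dDiv m n h φ1 φ2 i j * p i j = 0 := by
    intro φ1 φ2
    have : q (divL m n h (mkFlow m n φ1 φ2)) = 0 := hq2 ⟨_, rfl⟩
    rw [hp] at this
    exact this
  have K := H (dGrad1 m n h p) (dGrad2 m n h p)
  rw [ibp, neg_eq_zero, Finset.sum_eq_zero_iff_of_nonneg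
    (fun i _ => Finset.sum_nonneg fun j _ => by nlinarith [sq_nonneg (dGrad1 m n h p i j), sq_nonneg (dGrad2 m n h p i j)])] at K
  have K2 : ∀ i j, dGrad1 m n h p i j * dGrad1 m n h p i j + dGrad2 m n h p i j * dGrad2 m n h p i j = 0 := by
    intro i j
    have := K i (Finset.mem_univ _)
    rw [Finset.sum_eq_zero_iff_of_nonneg
      (fun j _ => by nlinarith [sq_nonneg (dGrad1 m n h p i j), sq_nonneg (dGrad2 m n h p i j)])] at this
    exact this j (Finset.mem_univ _)
  have C := const_of_grad m n h hh p
    (fun i j => by have := K2 i j; exact mul_self_eq_zero.1 (by nlinarith [mul_self_nonneg (dGrad1 m n h p i j), mul_self_nonneg (dGrad2 m n h p i j)]))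
    (fun i j => by have := K2 i j; exact mul_self_eq_zero.1 (by nlinarith [mul_self_nonneg (dGrad1 m n h p i j), mul_self_nonneg (dGrad2 m n h p i j)]))
    hm hn
  apply hq
  rw [hp]
  simp_rw [C, ← Finset.sum_mul, hg, zero_mul]

theorem strong_abs {E G : Type*} [NormedAddCommGroup E] [NormedSpace ℝ E] [FiniteDimensional ℝ E]
    [AddCommGroup G] [Module ℝ G] (D : E →ₗ[ℝ] G) (x0 : E) :
    ∃ xs, D xs = D x0 ∧ ∃ q : G →ₗ[ℝ] ℝ, (∀ x, q (D x) ≤ ‖x‖) ∧ q (D xs) = ‖xs‖ := by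
  have : ProperSpace E := FiniteDimensional.proper ℝ E
  set S := LinearMap.ker D with hS
  have hcl : IsClosed (S : Set E) := S.closed_of_finiteDimensional
  obtain ⟨y, hy, hy2⟩ := hcl.exists_infDist_eq_dist ⟨0, S.zero_mem⟩ x0
  have : IsClosed (S : Set E) := hcl
  obtain ⟨f, hf1, hf2⟩ := exists_dual_vector'' ℝ (S.mkQ x0)
  have hnorm : ‖S.mkQ x0‖ = ‖x0 - y‖ := by
    rw [← dist_eq_norm, ← hy2]
    exact QuotientAddGroup.norm_mk (S := S.toAddSubgroup) x0
  let F : E →ₗ[ℝ] ℝ := (f : (E ⧸ S) →ₗ[ℝ] ℝ) ∘ₗ S.mkQ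
  have hF : F ∈ LinearMap.range D.dualMap := by
    rw [LinearMap.range_dualMap_eq_dualAnnihilator_ker, Submodule.mem_dualAnnihilator]
    intro w hw
    have : S.mkQ w = 0 := (Submodule.Quotient.mk_eq_zero S).2 hw
    simp only [F, LinearMap.comp_apply, this, map_zero]
  obtain ⟨q, hq⟩ := hF
  have hqF : ∀ x, q (D x) = f (S.mkQ x) := fun x => LinearMap.congr_fun hq x
  have hy0 : D y = 0 := hy
  refine ⟨x0 - y, by rw [map_sub, hy0, sub_zero], q, ?_, ?_⟩
  · intro x
    rw [hqF]
    calc f (S.mkQ x) ≤ ‖f (S.mkQ x)‖ := le_abs_self _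
      _ ≤ ‖f‖ * ‖S.mkQ x‖ := f.le_opNorm _
      _ ≤ 1 * ‖S.mkQ x‖ := by gcongr
      _ ≤ ‖x‖ := by rw [one_mul]; exact Submodule.Quotient.norm_mk_le S x
  · rw [map_sub D, hy0, sub_zero, hqF, hf2, hnorm]
    rfl

theorem strong (m n : ℕ) (h : ℝ) (Φ0 : FlowSp m n) :
    ∃ Φs, divL m n h Φs = divL m n h Φ0 ∧ ∃ p : Fin m → Fin n → ℝ,
      (∀ Φ : FlowSp m n, ∑ i : Fin m, ∑ j : Fin n, divL m n h Φ i j * p i j ≤ ‖Φ‖) ∧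
      ∑ i : Fin m, ∑ j : Fin n, divL m n h Φs i j * p i j = ‖Φs‖ := by
  obtain ⟨Φs, h1, q, h2, h3⟩ := strong_abs (divL m n h) Φ0
  obtain ⟨p, hp⟩ := dual_repr m n q
  exact ⟨Φs, h1, p, fun Φ => (hp _).symm.trans_le (h2 Φ), (hp _).symm.trans h3⟩

/-- Discrete Beckmann/Kantorovich duality: for `g` with zero total sum,
the discrete Beckmann problem
`min { h² Σ ‖Φ_{i,j}‖₂ : div_h Φ = g }` (whose feasible set is nonempty) and the discrete
Kantorovich problem `max { h² Σ g_{i,j} p_{i,j} : ‖(∇_h p)_{i,j}‖₂ ≤ 1 ∀ (i,j) }` are both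
attained and have the same optimal value. -/
theorem stmt13 (m n : ℕ) (hm : 1 ≤ m) (hn : 1 ≤ n) (h : ℝ) (hh : 0 < h)
    (g : Fin m → Fin n → ℝ) (hg : ∑ i : Fin m, ∑ j : Fin n, g i j = 0) :
    (∃ φ1 φ2 : Fin m → Fin n → ℝ, ∀ i j, dDiv m n h φ1 φ2 i j = g i j) ∧
    (∃ φ1s φ2s : Fin m → Fin n → ℝ,
      (∀ i j, dDiv m n h φ1s φ2s i j = g i j) ∧
      (∀ φ1 φ2 : Fin m → Fin n → ℝ, (∀ i j, dDiv m n h φ1 φ2 i j = g i j) →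
        h ^ 2 * ∑ i : Fin m, ∑ j : Fin n, Real.sqrt (φ1s i j ^ 2 + φ2s i j ^ 2)
          ≤ h ^ 2 * ∑ i : Fin m, ∑ j : Fin n, Real.sqrt (φ1 i j ^ 2 + φ2 i j ^ 2)) ∧
      ∃ ps : Fin m → Fin n → ℝ,
        (∀ i j, Real.sqrt (dGrad1 m n h ps i j ^ 2 + dGrad2 m n h ps i j ^ 2) ≤ 1) ∧
        (∀ p : Fin m → Fin n → ℝ,
          (∀ i j, Real.sqrt (dGrad1 m n h p i j ^ 2 + dGrad2 m n h p i j ^ 2) ≤ 1) →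
          h ^ 2 * ∑ i : Fin m, ∑ j : Fin n, g i j * p i j
            ≤ h ^ 2 * ∑ i : Fin m, ∑ j : Fin n, g i j * ps i j) ∧
        h ^ 2 * ∑ i : Fin m, ∑ j : Fin n, Real.sqrt (φ1s i j ^ 2 + φ2s i j ^ 2)
          = h ^ 2 * ∑ i : Fin m, ∑ j : Fin n, g i j * ps i j) := by
  obtain ⟨Φ0, h0⟩ := feas m n hm hn h hh g hg
  obtain ⟨Φs, hs, p, hp1, hp2⟩ := strong m n h Φ0
  rw [h0] at hs
  have hd : ∀ i j, dDiv m n h (fun i j => Φs (i, j) 0) (fun i j => Φs (i, j) 1) i j = g i j :=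
    fun i j => congrFun (congrFun hs i) j
  have hH : ∀ φ1 φ2 : Fin m → Fin n → ℝ,
      ∑ i : Fin m, ∑ j : Fin n, dDiv m n h φ1 φ2 i j * p i j
      ≤ ∑ i : Fin m, ∑ j : Fin n, Real.sqrt (φ1 i j ^ 2 + φ2 i j ^ 2) := by
    intro φ1 φ2
    have := hp1 (mkFlow m n φ1 φ2)
    rw [norm_flow] at this
    exact this
  rw [hs, norm_flow] at hp2
  have hh2 : 0 ≤ h ^ 2 := sq_nonneg h
  refine ⟨⟨_, _, hd⟩, _, _, hd, ?_, p, grad_le m n h p hH, ?_, ?_⟩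
  · intro φ1 φ2 hφ
    refine mul_le_mul_of_nonneg_left ?_ hh2
    rw [← hp2]
    have := hH φ1 φ2
    simpa only [hφ] using this
  · intro p' hp'
    refine mul_le_mul_of_nonneg_left ?_ hh2
    rw [hp2]
    have := weak_dual m n h (fun i j => Φs (i, j) 0) (fun i j => Φs (i, j) 1) p' hp'
    simpa only [hd] using this
  · rw [hp2]
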